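/- Let μ be a partition all of whose parts are even, and let ν be a partition of an even number. Then (μ ∪ ν)_C = μ ∪ ν_C; that is, the C-collapse of the union μ ∪ ν equals the union of μ with the C-collapse of ν. -/

import Mathlib

namespace WFPaper

/-- The list of parts of a partition (multiset of positive integers) in weakly
decreasing order. -/
def sortedDesc (s : Multiset ℕ) : List ℕ := (s.sort (· ≤ ·)).reverse

/-- The `j`-th largest part of `s` (1-indexed); `0` if `j = 0` or `j > #s`. -/
def part (s : Multiset ℕ) (j : ℕ) : ℕ := (sortedDesc s).getD (j - 1) 0

/-- The smallest part of `s` (`0` if `s` is empty). -/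
def minPart (s : Multiset ℕ) : ℕ := (s.sort (· ≤ ·)).getD 0 0

/-- Sum of the `j` largest parts of `s`. -/
def psum (s : Multiset ℕ) (j : ℕ) : ℕ := ((sortedDesc s).take j).sum

/-- Dominance order: `DomLE a b` means `a ≤ b` in the dominance order, i.e.
for every `j` the sum of the `j` largest parts of `a` is at most that of `b`. -/
def DomLE (a b : Multiset ℕ) : Prop := ∀ j, psum a j ≤ psum b j

/-- All parts are positive. -/
def PosParts (s : Multiset ℕ) : Prop := ∀ x ∈ s, 0 < x

/-- A partition of an odd number in which every even part has even multiplicity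
(a B-partition of `n` when the sum is `2*n+1`). -/
def IsTypeB (s : Multiset ℕ) : Prop :=
  PosParts s ∧ Odd s.sum ∧ ∀ x, Even x → Even (s.count x)

/-- A partition of an even number in which every odd part has even multiplicity
(a C-partition of `n` when the sum is `2*n`). -/
def IsTypeC (s : Multiset ℕ) : Prop :=
  PosParts s ∧ Even s.sum ∧ ∀ x, Odd x → Even (s.count x)

/-- A partition of an even number in which every even part has even multiplicity
(a D-partition of `n` when the sum is `2*n`). -/
def IsTypeD (s : Multiset ℕ) : Prop :=
  PosParts s ∧ Even s.sum ∧ ∀ x, Even x → Even (s.count x)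

/-- `IsCollapse T α β` : `β` is the dominance-largest partition of class `T` of
the same number as `α` which is dominated by `α` (e.g. the B/C/D-collapse of `α`
for `T = IsTypeB/IsTypeC/IsTypeD`). -/
def IsCollapse (T : Multiset ℕ → Prop) (α β : Multiset ℕ) : Prop :=
  T β ∧ β.sum = α.sum ∧ DomLE β α ∧
    ∀ γ, T γ → γ.sum = α.sum → DomLE γ α → DomLE γ β

/-- The transpose (conjugate) partition: its `j`-th part (0-indexed `j`) is the
number of parts of `s` that are `≥ j+1`. -/
def transpose (s : Multiset ℕ) : Multiset ℕ :=
  (Multiset.range (part s 1)).map (fun j => (s.filter (fun x => j + 1 ≤ x)).card)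

/-- `λ⁻` : subtract 1 from the smallest part (the part being deleted if it
becomes 0). -/
def decMin (s : Multiset ℕ) : Multiset ℕ :=
  ((minPart s - 1) ::ₘ s.erase (minPart s)).filter (fun x => 0 < x)

/-- `λ⁺` : add 1 to the largest part. -/
def incMax (s : Multiset ℕ) : Multiset ℕ :=
  (part s 1 + 1) ::ₘ s.erase (part s 1)

/-- The subpartition `μ` of `T` whose multiplicity at an even `x` is 2 if
`m_T(x)` is even and nonzero, 1 if `m_T(x)` is odd, and 0 at odd `x`. -/
def muEven (T : Multiset ℕ) : Multiset ℕ :=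
  (T.toFinset.filter (fun x => Even x)).val.bind
    (fun x => Multiset.replicate (if Even (T.count x) then 2 else 1) x)

/-- The subpartition `μ` of `T` whose multiplicity at an odd `x` is 2 if
`m_T(x)` is even and nonzero, 1 if `m_T(x)` is odd, and 0 at even `x`. -/
def muOdd (T : Multiset ℕ) : Multiset ℕ :=
  (T.toFinset.filter (fun x => Odd x)).val.bind
    (fun x => Multiset.replicate (if Even (T.count x) then 2 else 1) x)

/-- The subpartition `π` of `T` consisting of the even parts of `T` of odd
multiplicity, each taken once. -/
def piEven (T : Multiset ℕ) : Multiset ℕ :=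
  (T.toFinset.filter (fun x => Even x ∧ Odd (T.count x))).val

/-- `k` is a (1-indexed) position of an odd part of `s`. -/
def OddIdx (s : Multiset ℕ) (k : ℕ) : Prop := 1 ≤ k ∧ Odd (part s k)

/-- `k` is a (1-indexed) position of an even part of `s`. -/
def EvenIdx (s : Multiset ℕ) (k : ℕ) : Prop :=
  1 ≤ k ∧ k ≤ Multiset.card s ∧ Even (part s k)

/-- `e_s(i,j)` : number of positions `i ≤ k ≤ j` with `s_k` even. -/
def eCount (s : Multiset ℕ) (i j : ℕ) : ℕ :=
  ((Finset.Icc i j).filter (fun k => Even (part s k))).card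

/-- number of positions `i ≤ k ≤ j` with `s_k` odd. -/
def oCount (s : Multiset ℕ) (i j : ℕ) : ℕ :=
  ((Finset.Icc i j).filter (fun k => Odd (part s k))).card

/-- `s` is special in the e-count sense: `e_s(1,t₁)` is even, and
`e_s(tᵢ,tᵢ₊₁)` is even for all `1 ≤ i ≤ p-1`, where `t₁ < ⋯ < t_p` are the
positions of the odd parts of `s`. -/
def IsSpecialE (s : Multiset ℕ) : Prop :=
  (∀ t, OddIdx s t → (∀ t', OddIdx s t' → t ≤ t') → Even (eCount s 1 t)) ∧
  (∀ i j, OddIdx s i → OddIdx s j → i < j →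
    (∀ k, OddIdx s k → k ≤ i ∨ j ≤ k) → Even (eCount s i j))

/-- `s` is quasi-special: `e_s(1,t₁)` is even, `e_s(tᵢ,tᵢ₊₁)` is even for all
`1 ≤ i ≤ p-2`, and the smallest part of `s` is odd with multiplicity 1. -/
def IsQuasiSpecialE (s : Multiset ℕ) : Prop :=
  (∀ t, OddIdx s t → (∀ t', OddIdx s t' → t ≤ t') → Even (eCount s 1 t)) ∧
  (∀ i j, OddIdx s i → OddIdx s j → i < j →
    (∀ k, OddIdx s k → k ≤ i ∨ j ≤ k) → (∃ k, OddIdx s k ∧ j < k) →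
      Even (eCount s i j)) ∧
  Odd (minPart s) ∧ s.count (minPart s) = 1

/-- Number of odd parts greater than every even part (equals the number of odd
parts greater than the largest even part, and the number of all odd parts if
there are no even parts). -/
def numOddDominant (s : Multiset ℕ) : ℕ :=
  (s.filter (fun x => Odd x ∧ ∀ y ∈ s, Even y → y < x)).card

/-- Between every pair of consecutive even parts of `s` (in the decreasing
listing of the parts) there is an even number of odd parts. -/
def EvenBetween (s : Multiset ℕ) : Prop :=
  ∀ i j, EvenIdx s i → EvenIdx s j → i < j →
    (∀ k, EvenIdx s k → k ≤ i ∨ j ≤ k) → Even (oCount s i j)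

/-- A special B-partition. -/
def IsSpecialTypeB (s : Multiset ℕ) : Prop :=
  IsTypeB s ∧ EvenBetween s ∧ Odd (numOddDominant s)

/-- A special D-partition. -/
def IsSpecialTypeD (s : Multiset ℕ) : Prop :=
  IsTypeD s ∧ EvenBetween s ∧ Even (numOddDominant s)

/-- The excess of `s` over `t`, the sum of `max (x - t) 0` over the parts `x` of `s`. -/
def excess (s : Multiset ℕ) (t : ℕ) : ℕ := (s.map (fun x => x - t)).sum

lemma excess_add (a b : Multiset ℕ) (t : ℕ) : excess (a + b) t = excess a t + excess b t := by
  simp [excess]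

lemma excess_zero (s : Multiset ℕ) : excess s 0 = s.sum := by
  simp [excess]

lemma excess_second_difference (s : Multiset ℕ) (t : ℕ) :
    excess s t + excess s (t + 2) = 2 * excess s (t + 1) + s.count (t + 1) := by
  induction s using Multiset.induction_on with
  | empty => simp [excess]
  | cons a s ih =>
    simp only [excess, Multiset.map_cons, Multiset.sum_cons, Multiset.count_cons] at ih ⊢
    split_ifs <;> omega

lemma excess_one_add_card (s : Multiset ℕ) (hs : PosParts s) :
    excess s 1 + Multiset.card s = excess s 0 := by
  induction s using Multiset.induction_on with
  | empty => simp [excess]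
  | cons a s ih =>
    have ha := hs a (Multiset.mem_cons_self a s)
    have := ih fun x hx => hs x (Multiset.mem_cons_of_mem hx)
    simp only [excess, Multiset.map_cons, Multiset.sum_cons, Multiset.card_cons] at this ⊢
    omega

lemma excess_map_succ (s : Multiset ℕ) (t : ℕ) :
    excess (s.map (· + 1)) (t + 1) = excess s t := by
  simp [excess, Multiset.map_map]

lemma excess_replicate_one (k t : ℕ) : excess (Multiset.replicate k 1) (t + 1) = 0 := by
  simp [excess]

lemma excess_eq_zero (s : Multiset ℕ) {t : ℕ} (ht : s.sum ≤ t) : excess s t = 0 := by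
  refine Multiset.sum_eq_zero fun y hy => ?_
  obtain ⟨x, hx, rfl⟩ := Multiset.mem_map.1 hy
  have := Multiset.single_le_sum (fun _ _ => Nat.zero_le _) x hx
  omega

lemma eq_of_excess_eq {a b : Multiset ℕ} (ha : PosParts a) (hb : PosParts b)
    (h : ∀ t, excess a t = excess b t) : a = b := by
  ext x
  rcases x with _ | t
  · rw [Multiset.count_eq_zero_of_notMem fun h0 => (ha 0 h0).false,
      Multiset.count_eq_zero_of_notMem fun h0 => (hb 0 h0).false]
  · have h1 := excess_second_difference a t
    have h2 := excess_second_difference b t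
    simp only [h] at h1
    omega

/-- Every convex function `ℕ → ℕ` of finite support is the excess function of a partition. -/
lemma exists_excess_eq (N : ℕ) (f : ℕ → ℕ) (hconv : ∀ t, 2 * f (t + 1) ≤ f t + f (t + 2))
    (hzero : ∀ t, N ≤ t → f t = 0) : ∃ e, PosParts e ∧ ∀ t, excess e t = f t := by
  induction N generalizing f with
  | zero => exact ⟨0, by simp [PosParts], fun t => by simp [excess, hzero t]⟩
  | succ N ih =>
    obtain ⟨e, he, hef⟩ := ih (fun t => f (t + 1)) (fun t => hconv (t + 1))
      (fun t ht => hzero (t + 1) (by omega))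
    refine ⟨e.map (· + 1) + Multiset.replicate (f 0 + f 2 - 2 * f 1) 1, ?_, ?_⟩
    · intro x hx
      rcases Multiset.mem_add.1 hx with hx | hx
      · obtain ⟨y, -, rfl⟩ := Multiset.mem_map.1 hx
        omega
      · rw [Multiset.eq_of_mem_replicate hx]
        exact one_pos
    · rintro (_ | t)
      · have hcard := excess_one_add_card e he
        have h0 := hef 0
        have h1 := hef 1
        have hc := hconv 0
        have hsum : (e.map (· + 1)).sum = excess e 0 + Multiset.card e := by
          simp [excess, Multiset.sum_map_add]
        rw [excess_zero, Multiset.sum_add, hsum, Multiset.sum_replicate]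
        simp only [smul_eq_mul, mul_one, zero_add, Nat.reduceAdd] at *
        omega
      · rw [excess_add, excess_map_succ, excess_replicate_one, hef, add_zero]

lemma sum_take_le (l : List ℕ) (j t : ℕ) :
    (l.take j).sum ≤ j * t + (l.map (fun x => x - t)).sum := by
  induction l generalizing j with
  | nil => simp
  | cons x l ih =>
    rcases j with _ | j
    · simp
    · have := ih j
      simp only [List.take_succ_cons, List.sum_cons, List.map_cons, Nat.succ_mul]
      omega

lemma exists_sum_take_eq_of_threshold (l : List ℕ) (hl : l.Pairwise (· ≥ ·)) (t : ℕ) :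
    ∃ j, (l.take j).sum = j * t + (l.map (fun x => x - t)).sum := by
  induction l with
  | nil => exact ⟨0, by simp⟩
  | cons x l ih =>
    obtain ⟨hx, hl⟩ := List.pairwise_cons.1 hl
    by_cases hxt : x ≤ t
    · refine ⟨0, ?_⟩
      have : (l.map (fun y => y - t)).sum = 0 := by
        refine List.sum_eq_zero fun y hy => ?_
        obtain ⟨z, hz, rfl⟩ := List.mem_map.1 hy
        have := hx z hz
        omega
      simp [this, hxt]
    · obtain ⟨j, hj⟩ := ih hl
      refine ⟨j + 1, ?_⟩
      simp only [List.take_succ_cons, List.sum_cons, List.map_cons, Nat.succ_mul]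
      omega

lemma exists_sum_take_eq_of_length (l : List ℕ) (hl : l.Pairwise (· ≥ ·)) (j M : ℕ)
    (hM : ∀ x ∈ l, x ≤ M) :
    ∃ t ≤ M, (l.take j).sum = j * t + (l.map (fun x => x - t)).sum := by
  induction l generalizing j M with
  | nil => exact ⟨0, by simp, by simp⟩
  | cons x l ih =>
    obtain ⟨hx, hl⟩ := List.pairwise_cons.1 hl
    have hxM := hM x List.mem_cons_self
    rcases j with _ | j
    · refine ⟨x, hxM, ?_⟩
      have : (l.map (fun y => y - x)).sum = 0 := by
        refine List.sum_eq_zero fun y hy => ?_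
        obtain ⟨z, hz, rfl⟩ := List.mem_map.1 hy
        have := hx z hz
        omega
      simp [this]
    · obtain ⟨t, ht, hj⟩ := ih hl j x hx
      refine ⟨t, ht.trans hxM, ?_⟩
      simp only [List.take_succ_cons, List.sum_cons, List.map_cons, Nat.succ_mul]
      omega

lemma pairwise_sortedDesc (s : Multiset ℕ) : (sortedDesc s).Pairwise (· ≥ ·) := by
  rw [sortedDesc, List.pairwise_reverse]
  exact s.pairwise_sort (· ≤ ·)

lemma sum_map_sortedDesc (s : Multiset ℕ) (t : ℕ) :
    ((sortedDesc s).map (fun x => x - t)).sum = excess s t := by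
  rw [excess, ← Multiset.sum_coe, ← Multiset.map_coe, sortedDesc, Multiset.coe_reverse,
    Multiset.sort_eq]

lemma domLE_iff_excess_le (a b : Multiset ℕ) :
    DomLE a b ↔ ∀ t, excess a t ≤ excess b t := by
  constructor
  · intro h t
    obtain ⟨j, hj⟩ := exists_sum_take_eq_of_threshold _ (pairwise_sortedDesc a) t
    have hb := sum_take_le (sortedDesc b) j t
    have := h j
    rw [sum_map_sortedDesc] at hj hb
    simp only [psum] at this
    omega
  · intro h j
    obtain ⟨t, -, ht⟩ := exists_sum_take_eq_of_length _ (pairwise_sortedDesc b) j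
      (sortedDesc b).sum fun x hx => List.le_sum_of_mem hx
    have ha := sum_take_le (sortedDesc a) j t
    have := h t
    rw [sum_map_sortedDesc] at ht ha
    simp only [psum]
    omega

lemma even_excess_of_count {s : Multiset ℕ} (hs : Even s.sum)
    (hcount : ∀ x, Odd x → Even (s.count x)) (k : ℕ) : Even (excess s (2 * k)) := by
  induction k with
  | zero => rwa [mul_zero, excess_zero]
  | succ k ih =>
    have h := excess_second_difference s (2 * k)
    have hc := hcount (2 * k + 1) ⟨k, rfl⟩
    rw [Nat.even_iff] at *
    rw [show 2 * (k + 1) = 2 * k + 2 by ring]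
    omega

lemma isTypeC_iff_even_excess {s : Multiset ℕ} (hs : PosParts s) :
    IsTypeC s ↔ ∀ k, Even (excess s (2 * k)) := by
  refine ⟨fun h => even_excess_of_count h.2.1 h.2.2, fun h => ⟨hs, ?_, ?_⟩⟩
  · simpa [excess_zero] using h 0
  · rintro x ⟨k, rfl⟩
    have h1 := excess_second_difference s (2 * k)
    have h2 := h k
    have h3 := h (k + 1)
    rw [Nat.even_iff] at *
    rw [show 2 * (k + 1) = 2 * k + 2 by ring] at h3
    omega

/-- The excess function of the C-collapse of `s`. -/
def collapseExcess (s : Multiset ℕ) (t : ℕ) : ℕ :=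
  if Even t then 2 * (excess s t / 2)
  else min (excess s t) (excess s (t - 1) / 2 + excess s (t + 1) / 2)

lemma collapseExcess_two_mul (s : Multiset ℕ) (k : ℕ) :
    collapseExcess s (2 * k) = 2 * (excess s (2 * k) / 2) := by
  simp [collapseExcess]

lemma collapseExcess_two_mul_add_one (s : Multiset ℕ) (k : ℕ) :
    collapseExcess s (2 * k + 1) =
      min (excess s (2 * k + 1)) (excess s (2 * k) / 2 + excess s (2 * k + 2) / 2) := by
  simp [collapseExcess]

lemma collapseExcess_le (s : Multiset ℕ) (t : ℕ) : collapseExcess s t ≤ excess s t := by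
  unfold collapseExcess
  split_ifs <;> omega

lemma collapseExcess_convex (s : Multiset ℕ) (t : ℕ) :
    2 * collapseExcess s (t + 1) ≤ collapseExcess s t + collapseExcess s (t + 2) := by
  rcases Nat.even_or_odd' t with ⟨k, rfl | rfl⟩
  · have h := collapseExcess_two_mul s (k + 1)
    rw [show 2 * (k + 1) = 2 * k + 2 by ring] at h
    rw [h, collapseExcess_two_mul, collapseExcess_two_mul_add_one]
    omega
  · have h := collapseExcess_two_mul s (k + 1)
    have h' := collapseExcess_two_mul_add_one s (k + 1)
    rw [show 2 * (k + 1) = 2 * k + 2 by ring] at h h'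
    rw [collapseExcess_two_mul_add_one, show 2 * k + 1 + 1 = 2 * k + 2 by ring,
      show 2 * k + 1 + 2 = 2 * k + 2 + 1 by ring, h, h']
    have h0 := excess_second_difference s (2 * k)
    have h1 := excess_second_difference s (2 * k + 1)
    have h2 := excess_second_difference s (2 * k + 2)
    simp only [add_assoc, Nat.reduceAdd] at *
    omega

lemma excess_le_collapseExcess {g s : Multiset ℕ} (hg : IsTypeC g)
    (h : ∀ t, excess g t ≤ excess s t) (t : ℕ) : excess g t ≤ collapseExcess s t := by
  have heven := (isTypeC_iff_even_excess hg.1).1 hg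
  rcases Nat.even_or_odd' t with ⟨k, rfl | rfl⟩
  · have h1 := heven k
    have h2 := h (2 * k)
    rw [collapseExcess_two_mul]
    rw [Nat.even_iff] at h1
    omega
  · have h1 := heven k
    have h2 := heven (k + 1)
    rw [show 2 * (k + 1) = 2 * k + 2 by ring] at h2
    rw [Nat.even_iff] at h1 h2
    have h3 := h (2 * k)
    have h4 := h (2 * k + 1)
    have h5 := h (2 * k + 2)
    have h6 := excess_second_difference g (2 * k)
    rw [collapseExcess_two_mul_add_one]
    omega

lemma exists_isTypeC_excess_eq {s : Multiset ℕ} (hs : Even s.sum) :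
    ∃ e, IsTypeC e ∧ e.sum = s.sum ∧ ∀ t, excess e t = collapseExcess s t := by
  obtain ⟨e, he, hes⟩ := exists_excess_eq s.sum (collapseExcess s) (collapseExcess_convex s)
    fun t ht => Nat.le_zero.1 ((collapseExcess_le s t).trans (excess_eq_zero s ht).le)
  refine ⟨e, (isTypeC_iff_even_excess he).2 fun k => ?_, ?_, hes⟩
  · rw [hes, collapseExcess_two_mul]
    exact even_two_mul _
  · have h := hes (2 * 0)
    rw [collapseExcess_two_mul, mul_zero, excess_zero, excess_zero] at h
    rw [h, Nat.two_mul_div_two_of_even hs]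

lemma collapseExcess_add {mu : Multiset ℕ} (hmu : ∀ x ∈ mu, Even x) (nu : Multiset ℕ) (t : ℕ) :
    collapseExcess (mu + nu) t = excess mu t + collapseExcess nu t := by
  have hcount : ∀ x, Odd x → mu.count x = 0 := fun x hx =>
    Multiset.count_eq_zero_of_notMem fun hmem => Nat.not_even_iff_odd.2 hx (hmu x hmem)
  have heven := even_excess_of_count (Multiset.sum_induction Even mu
    (fun _ _ => Even.add) Even.zero hmu) fun x hx => by simp [hcount x hx]
  rcases Nat.even_or_odd' t with ⟨k, rfl | rfl⟩
  · have h1 := heven k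
    rw [Nat.even_iff] at h1
    rw [collapseExcess_two_mul, collapseExcess_two_mul, excess_add]
    omega
  · have h1 := heven k
    have h2 := heven (k + 1)
    rw [show 2 * (k + 1) = 2 * k + 2 by ring] at h2
    rw [Nat.even_iff] at h1 h2
    have h3 := excess_second_difference mu (2 * k)
    rw [hcount _ ⟨k, rfl⟩] at h3
    simp only [collapseExcess_two_mul_add_one, excess_add]
    omega

/-- If `μ` is a partition all of whose parts are even and `ν` is
a partition of an even number, then `(μ ∪ ν)_C = μ ∪ ν_C`. -/
theorem statement15 (mu nu : Multiset ℕ)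
    (hmupos : PosParts mu) (hmueven : ∀ x ∈ mu, Even x)
    (hnupos : PosParts nu) (hnusum : Even nu.sum)
    (c d : Multiset ℕ)
    (hc : IsCollapse IsTypeC (mu + nu) c) (hd : IsCollapse IsTypeC nu d) :
    c = mu + d := by
  obtain ⟨hcC, -, hcle, hcmax⟩ := hc
  obtain ⟨hdC, hdsum, hdle, hdmax⟩ := hd
  rw [domLE_iff_excess_le] at hcle hdle
  have hpos : PosParts (mu + d) := fun x hx =>
    (Multiset.mem_add.1 hx).elim (hmupos x) (hdC.1 x)
  have hC : IsTypeC (mu + d) := by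
    refine ⟨hpos, ?_, fun x hx => ?_⟩
    · rw [Multiset.sum_add]
      exact (Multiset.sum_induction Even mu (fun _ _ => Even.add) Even.zero hmueven).add hdC.2.1
    · rw [Multiset.count_add, Multiset.count_eq_zero_of_notMem
        fun hmem => Nat.not_even_iff_odd.2 hx (hmueven x hmem), zero_add]
      exact hdC.2.2 x hx
  have hle : ∀ t, excess (mu + d) t ≤ excess c t := by
    rw [← domLE_iff_excess_le]
    refine hcmax _ hC (by simp [hdsum]) ((domLE_iff_excess_le _ _).2 fun t => ?_)
    rw [excess_add, excess_add]
    exact Nat.add_le_add_left (hdle t) _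
  obtain ⟨e, heC, hesum, he⟩ := exists_isTypeC_excess_eq hnusum
  have hed := (domLE_iff_excess_le _ _).1 (hdmax e heC hesum
    ((domLE_iff_excess_le _ _).2 fun t => (he t).trans_le (collapseExcess_le nu t)))
  refine eq_of_excess_eq hcC.1 hpos fun t => le_antisymm ?_ (hle t)
  calc excess c t ≤ collapseExcess (mu + nu) t := excess_le_collapseExcess hcC hcle t
    _ = excess mu t + excess e t := by rw [collapseExcess_add hmueven, he]
    _ ≤ excess (mu + d) t := by
      rw [excess_add]
      exact Nat.add_le_add_left (hed t) _

end WFPaper
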